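/- Let (X,d_X) and (Y,d_Y) be bounded metric spaces, each with at least two points, let k > 0, and let T : LPM_k(X,d_X) → LPM_k(Y,d_Y) be a bijective sup-metric isometry satisfying T(Pp(X) ∩ LPM_k(X,d_X)) = Pp(Y) ∩ LPM_k(Y,d_Y). Then there exists a homeomorphism ϕ : Y → X such that T(d)(x,y) = d(ϕ(x), ϕ(y)) for every d ∈ LPM_k(X,d_X) and all x, y ∈ Y. If moreover neither X nor Y has exactly two points, then ϕ is unique. -/

import Mathlib

open Set Filter

namespace BanachStone

/-- `d` is a pseudometric. -/
def IsPseudometric {Z : Type*} (d : Z → Z → ℝ) : Prop :=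
  (∀ z, d z z = 0) ∧ (∀ z w, d z w = d w z) ∧ (∀ z w v, d z v ≤ d z w + d w v)

/-- `d` is bounded. -/
def IsBoundedPM {Z : Type*} (d : Z → Z → ℝ) : Prop := ∃ C : ℝ, ∀ z w, d z w ≤ C

/-- The sup-norm of `d`. -/
noncomputable def supNorm {Z : Type*} (d : Z → Z → ℝ) : ℝ := ⨆ p : Z × Z, d p.1 p.2

/-- The sup-metric between `d` and `ρ`. -/
noncomputable def supDist {Z : Type*} (d ρ : Z → Z → ℝ) : ℝ :=
  ⨆ p : Z × Z, |d p.1 p.2 - ρ p.1 p.2|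

/-- `PM Z`: bounded continuous pseudometrics on `Z`. -/
def PM (Z : Type*) [TopologicalSpace Z] : Set (Z → Z → ℝ) :=
  {d | IsPseudometric d ∧ IsBoundedPM d ∧ Continuous fun p : Z × Z => d p.1 p.2}

/-- The topology induced by `d` (generated by open `d`-balls). -/
def metricTopology {Z : Type*} (d : Z → Z → ℝ) : TopologicalSpace Z :=
  TopologicalSpace.generateFrom {s | ∃ z : Z, ∃ r : ℝ, s = {w | d z w < r}}

/-- `AM Z`: admissible metrics, i.e. bounded metrics inducing the topology of `Z`. -/
def AM (Z : Type*) [t : TopologicalSpace Z] : Set (Z → Z → ℝ) :=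
  {d | IsPseudometric d ∧ IsBoundedPM d ∧ (∀ z w : Z, z ≠ w → 0 < d z w) ∧
    metricTopology d = t}

/-- `Pp Z`: elements of `PM Z` attaining the sup-norm at exactly one unordered pair
of distinct points. -/
def Pp (Z : Type*) [TopologicalSpace Z] : Set (Z → Z → ℝ) :=
  {d | d ∈ PM Z ∧ ∃ z w : Z, z ≠ w ∧ d z w = supNorm d ∧
    ∀ z' w' : Z, z' ≠ w' → d z' w' = supNorm d → ({z', w'} : Set Z) = {z, w}}

/-- `UPM Z`: bounded pseudometrics uniformly continuous w.r.t. the uniformity of `Z`. -/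
def UPM (Z : Type*) [UniformSpace Z] : Set (Z → Z → ℝ) :=
  {d | IsPseudometric d ∧ IsBoundedPM d ∧
    ∀ ε : ℝ, 0 < ε → ∃ U ∈ uniformity Z, ∀ x y : Z, (x, y) ∈ U → d x y < ε}

/-- `UC Z`: bounded uniformly continuous real-valued functions on `Z`. -/
def UC (Z : Type*) [UniformSpace Z] : Set (Z → ℝ) :=
  {f | (∃ C : ℝ, ∀ z, |f z| ≤ C) ∧ UniformContinuous f}

/-- The space `U(Z)`. -/
def Ucal (Z : Type*) [UniformSpace Z] : Set (Z → Z → ℝ) :=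
  {d | d ∈ PM Z ∧ ∀ ε : ℝ, 0 < ε → ∃ F : Finset (Z → ℝ), F.Nonempty ∧
    (↑F : Set (Z → ℝ)) ⊆ UC Z ∧ ∃ δ : ℝ, 0 < δ ∧
    ∀ x y : Z, (∀ f ∈ F, |f x - f y| < δ) → d x y < ε}

/-- The uniformity filter of the coarsest uniformity on `Z` making every bounded
uniformly continuous real-valued function on `Z` uniformly continuous. -/
noncomputable def U0 (Z : Type*) [UniformSpace Z] : Filter (Z × Z) :=
  ⨅ f ∈ UC Z, Filter.comap (fun p : Z × Z => (f p.1, f p.2)) (uniformity ℝ)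

/-- The Lipschitz constant of a pseudometric on a metric space. -/
noncomputable def lip {Z : Type*} [PseudoMetricSpace Z] (d : Z → Z → ℝ) : ENNReal :=
  ⨆ (x : Z) (y : Z) (_ : x ≠ y), ENNReal.ofReal (d x y / dist x y)

/-- `LPM Z`: bounded Lipschitz continuous pseudometrics on `Z`. -/
def LPM (Z : Type*) [MetricSpace Z] : Set (Z → Z → ℝ) :=
  {d | IsPseudometric d ∧ IsBoundedPM d ∧ lip d < ⊤}

/-- `LPM_k Z`: elements of `LPM Z` with Lipschitz constant `< k`. -/
def LPMlt (k : ℝ) (Z : Type*) [MetricSpace Z] : Set (Z → Z → ℝ) :=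
  {d | d ∈ LPM Z ∧ lip d < ENNReal.ofReal k}

/-- `\overline{LPM}_k Z`: elements of `LPM Z` with Lipschitz constant `≤ k`. -/
def LPMle (k : ℝ) (Z : Type*) [MetricSpace Z] : Set (Z → Z → ℝ) :=
  {d | d ∈ LPM Z ∧ lip d ≤ ENNReal.ofReal k}

/-- `Z` has exactly two points. -/
def ExactlyTwo (Z : Type*) : Prop := ∃ a b : Z, a ≠ b ∧ ∀ c : Z, c = a ∨ c = b

/-- The two-element subsets of `Z`. -/
def Dset (Z : Type*) : Set (Set Z) := {s | ∃ a b : Z, a ≠ b ∧ s = {a, b}}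

/-! ### Basic facts on bounded Lipschitz pseudometrics -/

section Basic

variable {Z : Type*}

lemma IsPseudometric.nonneg {d : Z → Z → ℝ} (hd : IsPseudometric d) (z w : Z) : 0 ≤ d z w := by
  have h := hd.2.2 z w z
  rw [hd.1, hd.2.1 w z] at h
  linarith

lemma le_supNorm {d : Z → Z → ℝ} (hb : IsBoundedPM d) (z w : Z) : d z w ≤ supNorm d := by
  obtain ⟨C, hC⟩ := hb
  exact le_ciSup (f := fun p : Z × Z => d p.1 p.2) ⟨C, by rintro _ ⟨p, rfl⟩; exact hC _ _⟩ (z, w)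

lemma supNorm_le [Nonempty Z] {d : Z → Z → ℝ} {C : ℝ} (h : ∀ z w, d z w ≤ C) : supNorm d ≤ C :=
  ciSup_le fun p => h p.1 p.2

lemma supDist_le [Nonempty Z] {d e : Z → Z → ℝ} {C : ℝ} (h : ∀ z w, |d z w - e z w| ≤ C) :
    supDist d e ≤ C :=
  ciSup_le fun p => h p.1 p.2

variable [MetricSpace Z] {k : ℝ}

lemma mem_LPMlt_iff (hk : 0 < k) {d : Z → Z → ℝ} :
    d ∈ LPMlt k Z ↔ IsPseudometric d ∧ IsBoundedPM d ∧
      ∃ K, 0 ≤ K ∧ K < k ∧ ∀ x y, d x y ≤ K * dist x y := by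
  constructor
  · rintro ⟨⟨hd, hb, htop⟩, hlt⟩
    refine ⟨hd, hb, (lip d).toReal, ENNReal.toReal_nonneg, ?_, fun x y => ?_⟩
    · exact (ENNReal.lt_ofReal_iff_toReal_lt htop.ne).1 hlt
    · rcases eq_or_ne x y with rfl | hxy
      · simp [hd.1]
      · have h : ENNReal.ofReal (d x y / dist x y) ≤ lip d :=
          le_iSup_of_le x (le_iSup_of_le y (le_iSup_of_le hxy le_rfl))
        have h' := (ENNReal.ofReal_le_iff_le_toReal htop.ne).1 h
        rwa [div_le_iff₀ (dist_pos.2 hxy)] at h'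
  · rintro ⟨hd, hb, K, hK0, hK, hl⟩
    have h : lip d ≤ ENNReal.ofReal K := by
      refine iSup_le fun x => iSup_le fun y => iSup_le fun hxy => ENNReal.ofReal_le_ofReal ?_
      rw [div_le_iff₀ (dist_pos.2 hxy)]
      exact hl x y
    exact ⟨⟨hd, hb, h.trans_lt ENNReal.ofReal_lt_top⟩,
      h.trans_lt ((ENNReal.ofReal_lt_ofReal_iff hk).2 hK)⟩

lemma LPMlt.isPseudometric {d : Z → Z → ℝ} (hd : d ∈ LPMlt k Z) : IsPseudometric d := hd.1.1

lemma LPMlt.nonneg {d : Z → Z → ℝ} (hd : d ∈ LPMlt k Z) (z w : Z) : 0 ≤ d z w :=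
  hd.1.1.nonneg z w

lemma LPMlt.le_supNorm {d : Z → Z → ℝ} (hd : d ∈ LPMlt k Z) (z w : Z) : d z w ≤ supNorm d :=
  BanachStone.le_supNorm hd.1.2.1 z w

lemma LPMlt.le_mul_dist (hk : 0 < k) {d : Z → Z → ℝ} (hd : d ∈ LPMlt k Z) (z w : Z) :
    d z w ≤ k * dist z w := by
  obtain ⟨-, -, K, -, hK, hl⟩ := (mem_LPMlt_iff hk).1 hd
  exact (hl z w).trans (mul_le_mul_of_nonneg_right hK.le dist_nonneg)

lemma LPMlt.abs_sub_le_supDist {d e : Z → Z → ℝ} (hd : d ∈ LPMlt k Z) (he : e ∈ LPMlt k Z)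
    (z w : Z) : |d z w - e z w| ≤ supDist d e := by
  refine le_ciSup (f := fun p : Z × Z => |d p.1 p.2 - e p.1 p.2|)
    ⟨supNorm d + supNorm e, ?_⟩ (z, w)
  rintro _ ⟨p, rfl⟩
  have h1 := LPMlt.le_supNorm hd p.1 p.2
  have h2 := LPMlt.le_supNorm he p.1 p.2
  have h3 := LPMlt.nonneg hd p.1 p.2
  have h4 := LPMlt.nonneg he p.1 p.2
  exact abs_le.2 ⟨by linarith, by linarith⟩

lemma LPMlt.supDist_zero {d : Z → Z → ℝ} (hd : d ∈ LPMlt k Z) :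
    supDist d (fun _ _ => 0) = supNorm d := by
  simp only [supDist, supNorm, sub_zero]
  exact iSup_congr fun p => abs_of_nonneg (LPMlt.nonneg hd _ _)

lemma LPMlt.mem_PM (hk : 0 < k) {d : Z → Z → ℝ} (hd : d ∈ LPMlt k Z) : d ∈ PM Z := by
  obtain ⟨hp, hb, -⟩ := (mem_LPMlt_iff hk).1 hd
  refine ⟨hp, hb, ?_⟩
  refine (LipschitzWith.of_dist_le_mul (K := ⟨2 * k, by positivity⟩) fun p q => ?_).continuous
  have h1 := LPMlt.le_mul_dist hk hd p.1 q.1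
  have h2 := LPMlt.le_mul_dist hk hd p.2 q.2
  have h3 : dist p.1 q.1 ≤ dist p q := le_max_left _ _
  have h4 : dist p.2 q.2 ≤ dist p q := le_max_right _ _
  have h5 := mul_le_mul_of_nonneg_left h3 hk.le
  have h6 := mul_le_mul_of_nonneg_left h4 hk.le
  have t1 := hp.2.2 p.1 q.1 p.2
  have t2 := hp.2.2 q.1 q.2 p.2
  have t3 := hp.2.2 q.1 p.1 q.2
  have t4 := hp.2.2 p.1 p.2 q.2
  have s1 := hp.2.1 p.1 q.1
  have s2 := hp.2.1 p.2 q.2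
  change |d p.1 p.2 - d q.1 q.2| ≤ 2 * k * dist p q
  exact abs_le.2 ⟨by linarith, by linarith⟩

lemma zero_mem_LPMlt (hk : 0 < k) : (fun _ _ => 0 : Z → Z → ℝ) ∈ LPMlt k Z :=
  (mem_LPMlt_iff hk).2 ⟨⟨by simp, by simp, by simp⟩, ⟨0, by simp⟩, 0, le_rfl, hk, by simp⟩

lemma LPMlt.convex (hk : 0 < k) {d e : Z → Z → ℝ} (hd : d ∈ LPMlt k Z) (he : e ∈ LPMlt k Z)
    {s t : ℝ} (hs : 0 ≤ s) (ht : 0 ≤ t) (hst : s + t ≤ 1) :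
    (fun x y => s * d x y + t * e x y) ∈ LPMlt k Z := by
  obtain ⟨hd, ⟨C, hC⟩, K, hK0, hK, hl⟩ := (mem_LPMlt_iff hk).1 hd
  obtain ⟨he, ⟨C', hC'⟩, K', hK0', hK', hl'⟩ := (mem_LPMlt_iff hk).1 he
  refine (mem_LPMlt_iff hk).2 ⟨⟨fun z => by simp [hd.1, he.1], fun z w => ?_, fun z w v => ?_⟩,
    ⟨s * C + t * C', fun z w => ?_⟩, max K K', le_max_of_le_left hK0, max_lt hK hK',
    fun x y => ?_⟩
  · simp only [hd.2.1 z w, he.2.1 z w]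
  · have h1 := mul_le_mul_of_nonneg_left (hd.2.2 z w v) hs
    have h2 := mul_le_mul_of_nonneg_left (he.2.2 z w v) ht
    simp only
    linarith
  · have h1 := mul_le_mul_of_nonneg_left (hC z w) hs
    have h2 := mul_le_mul_of_nonneg_left (hC' z w) ht
    simp only
    linarith
  · have hm : 0 ≤ max K K' * dist x y := mul_nonneg (le_max_of_le_left hK0) dist_nonneg
    have a1 : d x y ≤ max K K' * dist x y :=
      (hl x y).trans (mul_le_mul_of_nonneg_right (le_max_left _ _) dist_nonneg)
    have a2 : e x y ≤ max K K' * dist x y :=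
      (hl' x y).trans (mul_le_mul_of_nonneg_right (le_max_right _ _) dist_nonneg)
    have h1 := mul_le_mul_of_nonneg_left a1 hs
    have h2 := mul_le_mul_of_nonneg_left a2 ht
    have h3 := mul_le_mul_of_nonneg_right hst hm
    linarith

lemma LPMlt.smul_mem (hk : 0 < k) {d : Z → Z → ℝ} (hd : d ∈ LPMlt k Z) {s : ℝ} (hs : 0 ≤ s)
    (hs1 : s ≤ 1) : (fun x y => s * d x y) ∈ LPMlt k Z := by
  simpa using LPMlt.convex hk hd hd hs le_rfl (by linarith : s + 0 ≤ 1)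

/-- Dilating slightly stays inside `LPMlt k Z`. -/
lemma LPMlt.exists_dilate_mem (hk : 0 < k) {d : Z → Z → ℝ} (hd : d ∈ LPMlt k Z) :
    ∃ t, 0 < t ∧ t ≤ 1 ∧ (fun x y => (1 + t) * d x y) ∈ LPMlt k Z := by
  obtain ⟨hd, ⟨C, hC⟩, K, hK0, hK, hl⟩ := (mem_LPMlt_iff hk).1 hd
  have hpos : 0 < k - K := by linarith
  have ht : 0 < (k - K) / (2 * k) := by positivity
  refine ⟨(k - K) / (2 * k), ht, ?_, ?_⟩
  · rw [div_le_one (by positivity)]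
    linarith
  · set t := (k - K) / (2 * k) with htdef
    have htk : t * k = (k - K) / 2 := by rw [htdef]; field_simp
    have h1t : 0 ≤ 1 + t := by linarith
    refine (mem_LPMlt_iff hk).2 ⟨⟨fun z => by simp [hd.1], fun z w => ?_, fun z w v => ?_⟩,
      ⟨(1 + t) * C, fun z w => mul_le_mul_of_nonneg_left (hC z w) h1t⟩, (1 + t) * K,
      mul_nonneg h1t hK0, ?_, fun x y => ?_⟩
    · simp only [hd.2.1 z w]
    · have h1 := mul_le_mul_of_nonneg_left (hd.2.2 z w v) h1t
      simp only
      linarith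
    · have := mul_le_mul_of_nonneg_left hK.le ht.le
      linarith
    · have := mul_le_mul_of_nonneg_left (hl x y) h1t
      rw [mul_assoc]
      exact this

lemma LPMlt.min_const_mem (hk : 0 < k) {d : Z → Z → ℝ} (hd : d ∈ LPMlt k Z) {c : ℝ}
    (hc : 0 ≤ c) : (fun x y => min (d x y) c) ∈ LPMlt k Z := by
  obtain ⟨hd, ⟨C, hC⟩, K, hK0, hK, hl⟩ := (mem_LPMlt_iff hk).1 hd
  refine (mem_LPMlt_iff hk).2 ⟨⟨fun z => by simp [hd.1, hc], fun z w => ?_, fun z w v => ?_⟩,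
    ⟨c, fun z w => min_le_right _ _⟩, K, hK0, hK, fun x y => (min_le_left _ _).trans (hl x y)⟩
  · simp only [hd.2.1 z w]
  · have h1 := hd.2.2 z w v
    have h2 := hd.nonneg z w
    have h3 := hd.nonneg w v
    rcases min_cases (d z v) c with h | h <;> rcases min_cases (d z w) c with h' | h' <;>
      rcases min_cases (d w v) c with h'' | h'' <;> linarith

/-- Raising a Lipschitz pseudometric by `ε` as far as a multiple of the metric allows. -/
lemma LPMlt.min_add_mem (hk : 0 < k) {d : Z → Z → ℝ} (hd : d ∈ LPMlt k Z) {ε l : ℝ}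
    (hε : 0 ≤ ε) (hl0 : 0 ≤ l) (hlk : l < k) (hl : ∀ x y, d x y ≤ l * dist x y) :
    (fun x y => min (d x y + ε) (l * dist x y)) ∈ LPMlt k Z := by
  obtain ⟨hd, ⟨C, hC⟩, -⟩ := (mem_LPMlt_iff hk).1 hd
  refine (mem_LPMlt_iff hk).2 ⟨⟨fun z => by simp [hd.1, hε], fun z w => ?_, fun z w v => ?_⟩,
    ⟨C + ε, fun z w => (min_le_left _ _).trans (by linarith [hC z w])⟩, l, hl0, hlk,
    fun x y => min_le_right _ _⟩
  · simp only [hd.2.1 z w, dist_comm z w]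
  · have h1 := hd.2.2 z w v
    have h2 := hl z w
    have h3 := hl w v
    have h4 := mul_le_mul_of_nonneg_left (dist_triangle z w v) hl0
    rcases min_cases (d z v + ε) (l * dist z v) with h | h <;>
      rcases min_cases (d z w + ε) (l * dist z w) with h' | h' <;>
      rcases min_cases (d w v + ε) (l * dist w v) with h'' | h'' <;> linarith

/-- The pseudometric obtained from `d` by adding a shortcut of length `l` between `a` and `b`. -/
noncomputable def shortcut (d : Z → Z → ℝ) (a b : Z) (l : ℝ) (u v : Z) : ℝ :=
  min (d u v) (min (d u a + l + d b v) (d u b + l + d a v))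

lemma LPMlt.shortcut_mem (hk : 0 < k) {d : Z → Z → ℝ} (hd : d ∈ LPMlt k Z) (a b : Z) {l : ℝ}
    (hl0 : 0 ≤ l) : shortcut d a b l ∈ LPMlt k Z := by
  obtain ⟨hd, ⟨C, hC⟩, K, hK0, hK, hl⟩ := (mem_LPMlt_iff hk).1 hd
  refine (mem_LPMlt_iff hk).2 ⟨⟨fun z => ?_, fun z w => ?_, fun z w v => ?_⟩,
    ⟨C, fun z w => (min_le_left _ _).trans (hC z w)⟩, K, hK0, hK,
    fun x y => (min_le_left _ _).trans (hl x y)⟩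
  · have h1 := hd.nonneg z a
    have h2 := hd.nonneg z b
    have h3 := hd.nonneg a z
    have h4 := hd.nonneg b z
    simp only [shortcut, hd.1]
    exact min_eq_left (le_min (by linarith) (by linarith))
  · simp only [shortcut]
    rw [hd.2.1 z w, hd.2.1 z a, hd.2.1 b w, hd.2.1 z b, hd.2.1 a w,
      min_comm (d a z + l + d w b)]
    congr 2 <;> ring
  · have e1 : shortcut d a b l z v ≤ d z v := min_le_left _ _
    have e2 : shortcut d a b l z v ≤ d z a + l + d b v :=
      (min_le_right _ _).trans (min_le_left _ _)
    have e3 : shortcut d a b l z v ≤ d z b + l + d a v :=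
      (min_le_right _ _).trans (min_le_right _ _)
    have t1 := hd.2.2 z w v
    have t2 := hd.2.2 z w a
    have t3 := hd.2.2 z w b
    have t4 := hd.2.2 a w v
    have t5 := hd.2.2 b w v
    have t6 := hd.2.2 z a v
    have t7 := hd.2.2 z b v
    have s1 := hd.2.1 w a
    have s2 := hd.2.1 w b
    have n1 := hd.nonneg w a
    have n2 := hd.nonneg w b
    have key : ∀ r, (r = d z w ∨ r = d z a + l + d b w ∨ r = d z b + l + d a w) →
        ∀ r', (r' = d w v ∨ r' = d w a + l + d b v ∨ r' = d w b + l + d a v) →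
        shortcut d a b l z v ≤ r + r' := by
      rintro r (rfl | rfl | rfl) r' (rfl | rfl | rfl) <;> linarith
    refine key _ ?_ _ ?_ <;>
    · simp only [shortcut, min_def]
      split_ifs <;> simp

end Basic

/-! ### Peaks -/

section Peak

variable {Z : Type*} [MetricSpace Z] {k : ℝ}

/-- `d` attains its sup-norm at the pair `{x, y}` and at no other pair of distinct points. -/
def PeakAt (d : Z → Z → ℝ) (x y : Z) : Prop :=
  d x y = supNorm d ∧ ∀ u v, u ≠ v → d u v = supNorm d → ({u, v} : Set Z) = {x, y}

lemma PeakAt.mem_Pp (hk : 0 < k) {d : Z → Z → ℝ} (hd : d ∈ LPMlt k Z) {x y : Z} (hxy : x ≠ y)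
    (h : PeakAt d x y) : d ∈ Pp Z :=
  ⟨LPMlt.mem_PM hk hd, x, y, hxy, h.1, h.2⟩

lemma exists_peakAt_of_mem_Pp {d : Z → Z → ℝ} (hd : d ∈ Pp Z) :
    ∃ x y, x ≠ y ∧ PeakAt d x y := by
  obtain ⟨-, x, y, hxy, h⟩ := hd
  exact ⟨x, y, hxy, h⟩

lemma exists_peakAt (hk : 0 < k) {x y : Z} (hxy : x ≠ y) : ∃ p ∈ LPMlt k Z, PeakAt p x y ∧ 0 < p x y := by
  have hδ : 0 < dist x y := dist_pos.2 hxy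
  set δ := dist x y with hδdef
  let g : Z → Z → ℝ := fun a u => min (dist u a) δ
  have hg0 : ∀ a u, 0 ≤ g a u := fun a u => le_min dist_nonneg hδ.le
  have hgδ : ∀ a u, g a u ≤ δ := fun a u => min_le_right _ _
  have hg : ∀ a u v, |g a u - g a v| ≤ δ := fun a u v =>
    abs_le.2 ⟨by linarith [hg0 a u, hgδ a v], by linarith [hg0 a v, hgδ a u]⟩
  have hgl : ∀ a u v, |g a u - g a v| ≤ dist u v := by
    intro a u v
    have h := abs_min_sub_min_le_max (dist u a) δ (dist v a) δ
    have h' := abs_dist_sub_le u v a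
    rw [sub_self, abs_zero, max_eq_left (abs_nonneg _)] at h
    exact h.trans h'
  have hgeq : ∀ a u v, |g a u - g a v| = δ → u = a ∨ v = a := by
    intro a u v h
    rcases abs_cases (g a u - g a v) with h' | h'
    · right
      have h0 : g a v ≤ 0 := by linarith [hgδ a u]
      rcases min_le_iff.1 h0 with h1 | h1
      · exact dist_le_zero.1 h1
      · linarith
    · left
      have h0 : g a u ≤ 0 := by linarith [hgδ a v]
      rcases min_le_iff.1 h0 with h1 | h1
      · exact dist_le_zero.1 h1
      · linarith
  let p : Z → Z → ℝ := fun u v => k / 4 * (|g x u - g x v| + |g y u - g y v|)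
  have hk4 : 0 < k / 4 := by positivity
  have hple : ∀ u v, p u v ≤ k / 4 * (δ + δ) := fun u v =>
    mul_le_mul_of_nonneg_left (add_le_add (hg x u v) (hg y u v)) hk4.le
  have hpxy : p x y = k / 4 * (δ + δ) := by
    have h1 : g x x = 0 := by simp [g, hδ.le]
    have h2 : g y y = 0 := by simp [g, hδ.le]
    have h3 : g x y = δ := by simp [g, dist_comm y x, ← hδdef]
    have h4 : g y x = δ := by simp [g, ← hδdef]
    simp only [p, h1, h2, h3, h4, zero_sub, sub_zero, abs_neg, abs_of_pos hδ]
  have hp : p ∈ LPMlt k Z := by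
    refine (mem_LPMlt_iff hk).2 ⟨⟨fun z => by simp [p], fun z w => ?_, fun z w v => ?_⟩,
      ⟨_, hple⟩, k / 2, by positivity, by linarith, fun u v => ?_⟩
    · simp only [p, abs_sub_comm (g x z), abs_sub_comm (g y z)]
    · have h1 := abs_sub_le (g x z) (g x w) (g x v)
      have h2 := abs_sub_le (g y z) (g y w) (g y v)
      simp only [p, ← mul_add]
      exact mul_le_mul_of_nonneg_left (by linarith) hk4.le
    · have := mul_le_mul_of_nonneg_left (add_le_add (hgl x u v) (hgl y u v)) hk4.le
      simp only [p]
      linarith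
  have : Nonempty Z := ⟨x⟩
  have hnorm : supNorm p = k / 4 * (δ + δ) :=
    le_antisymm (supNorm_le hple) (hpxy ▸ LPMlt.le_supNorm hp x y)
  refine ⟨p, hp, ⟨hpxy.trans hnorm.symm, fun u v huv h => ?_⟩, hpxy ▸ by positivity⟩
  rw [hnorm] at h
  have hsum := mul_left_cancel₀ hk4.ne' h
  have h1 := hg x u v
  have h2 := hg y u v
  have hx := hgeq x u v (by linarith)
  have hy := hgeq y u v (by linarith)
  rw [Set.pair_eq_pair_iff]
  grind

/-- If two pairs of distinct points cannot be told apart by Lipschitz pseudometrics, they agree. -/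
lemma pair_eq_of_forall_eq (hk : 0 < k) {x y u v : Z} (hxy : x ≠ y)
    (h : ∀ d ∈ LPMlt k Z, d u v = d x y) : u = x ∧ v = y ∨ u = y ∧ v = x := by
  obtain ⟨p, hp, hpeak, hpos⟩ := exists_peakAt hk hxy
  have huv : u ≠ v := by
    rintro rfl
    rw [← h p hp, (LPMlt.isPseudometric hp).1] at hpos
    exact lt_irrefl _ hpos
  rw [← Set.pair_eq_pair_iff]
  exact hpeak.2 u v huv ((h p hp).trans hpeak.1)

lemma PeakAt.convex (hk : 0 < k) {p e : Z → Z → ℝ} (hp : p ∈ LPMlt k Z) (he : e ∈ LPMlt k Z)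
    {x y : Z} (hpeak : PeakAt p x y) (hatt : e x y = supNorm e) {s t : ℝ} (hs : 0 ≤ s)
    (ht : 0 < t) (hst : s + t ≤ 1) :
    PeakAt (fun u v => s * e u v + t * p u v) x y := by
  have : Nonempty Z := ⟨x⟩
  have hmem := LPMlt.convex hk he hp hs ht.le hst
  have h1 := fun u v => mul_le_mul_of_nonneg_left (LPMlt.le_supNorm he u v) hs
  have h2 := fun u v => mul_le_mul_of_nonneg_left (LPMlt.le_supNorm hp u v) ht.le
  have hnorm : supNorm (fun u v => s * e u v + t * p u v) = s * supNorm e + t * supNorm p := by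
    refine le_antisymm (supNorm_le fun u v => add_le_add (h1 u v) (h2 u v)) ?_
    have := LPMlt.le_supNorm hmem x y
    rwa [hatt, hpeak.1] at this
  refine ⟨by rw [hnorm, ← hatt, ← hpeak.1], fun u v huv h => hpeak.2 u v huv ?_⟩
  rw [hnorm] at h
  have h3 := h1 u v
  exact le_antisymm (LPMlt.le_supNorm hp u v) (le_of_mul_le_mul_left (by linarith) ht)

lemma PeakAt.const_mul (hk : 0 < k) {p : Z → Z → ℝ} (hp : p ∈ LPMlt k Z) {x y : Z}
    (hpeak : PeakAt p x y) {t : ℝ} (ht : 0 < t) (ht1 : t ≤ 1) :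
    PeakAt (fun u v => t * p u v) x y := by
  simpa using hpeak.convex hk hp hp hpeak.1 le_rfl ht (by linarith : 0 + t ≤ 1)

/-- If `d` lies between `0` and `c`, then `d` attains its norm wherever `c` does. -/
lemma attains_of_supDist_le {c d : Z → Z → ℝ} (hc : c ∈ LPMlt k Z) (hd : d ∈ LPMlt k Z)
    (h : supDist c d ≤ supNorm c - supNorm d) {x y : Z} (hatt : c x y = supNorm c) :
    d x y = supNorm d := by
  have h1 := (le_abs_self _).trans (LPMlt.abs_sub_le_supDist hc hd x y)
  exact le_antisymm (LPMlt.le_supNorm hd x y) (by linarith)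

/-- If `d` lies between `0` and `c`, then `c` attains its norm wherever `d` does, provided
both are peaked. -/
lemma attains_of_supDist_le_of_mem_Pp {c d : Z → Z → ℝ} (hc : c ∈ LPMlt k Z)
    (hd : d ∈ LPMlt k Z) (h : supDist c d ≤ supNorm c - supNorm d) (hcP : c ∈ Pp Z)
    (hdP : d ∈ Pp Z) {x y : Z} (hxy : x ≠ y) (hatt : d x y = supNorm d) :
    c x y = supNorm c := by
  obtain ⟨u, v, huv, hcpk⟩ := exists_peakAt_of_mem_Pp hcP
  obtain ⟨u', v', huv', hdpk⟩ := exists_peakAt_of_mem_Pp hdP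
  have h1 := hdpk.2 u v huv (attains_of_supDist_le hc hd h hcpk.1)
  have h2 := hdpk.2 x y hxy hatt
  rw [← h1, Set.pair_eq_pair_iff] at h2
  rcases h2 with ⟨rfl, rfl⟩ | ⟨rfl, rfl⟩
  · exact hcpk.1
  · rw [(LPMlt.isPseudometric hc).2.1, hcpk.1]

end Peak
/-- If `u` and `v` are joined by a path through the edges `{p, q}` and `{r, s}` using the edge
`{r, s}` from `r` to `s`, then the two edges share a vertex and meet `{u, v}` in its endpoints. -/
lemma exists_common_vertex {Z : Type*} {u v p q r s : Z} (huv : u ≠ v)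
    (hpq : ¬ (u = p ∧ v = q ∨ u = q ∧ v = p)) (hrs : ¬ (u = r ∧ v = s ∨ u = s ∧ v = r))
    (hur : u = r ∨ u = p ∧ r = q ∨ u = q ∧ r = p)
    (hsv : s = v ∨ s = p ∧ v = q ∨ s = q ∧ v = p) :
    ∃ t, t ≠ u ∧ t ≠ v ∧
      ((u = p ∧ t = q ∨ u = q ∧ t = p) ∧ (v = r ∧ t = s ∨ v = s ∧ t = r) ∨
       (v = p ∧ t = q ∨ v = q ∧ t = p) ∧ (u = r ∧ t = s ∨ u = s ∧ t = r)) := by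
  by_cases h : u = r
  · refine ⟨s, ?_, ?_, ?_⟩ <;> grind
  · refine ⟨r, ?_, ?_, ?_⟩ <;> grind

/-! ### Isometries preserving peaked pseudometrics -/

/-- `T` and `S` are mutually inverse isometries between spaces of Lipschitz pseudometrics, both
preserving peaked pseudometrics. -/
structure PeakIsometry (k : ℝ) {X Y : Type*} [MetricSpace X] [MetricSpace Y]
    (T : (X → X → ℝ) → (Y → Y → ℝ)) (S : (Y → Y → ℝ) → (X → X → ℝ)) : Prop where
  mapsTo : ∀ d ∈ LPMlt k X, T d ∈ LPMlt k Y
  mapsTo_inv : ∀ e ∈ LPMlt k Y, S e ∈ LPMlt k X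
  left_inv : ∀ d ∈ LPMlt k X, S (T d) = d
  right_inv : ∀ e ∈ LPMlt k Y, T (S e) = e
  iso : ∀ d ∈ LPMlt k X, ∀ e ∈ LPMlt k X, supDist (T d) (T e) = supDist d e
  peak : ∀ d ∈ LPMlt k X, d ∈ Pp X → T d ∈ Pp Y
  peak_inv : ∀ e ∈ LPMlt k Y, e ∈ Pp Y → S e ∈ Pp X

/-- `T d` attains its norm at `{y, y'}` whenever `d` attains its norm at `{x, x'}`. -/
def Carries (k : ℝ) {X Y : Type*} [MetricSpace X]
    (T : (X → X → ℝ) → (Y → Y → ℝ)) (x x' : X) (y y' : Y) : Prop :=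
  ∀ d ∈ LPMlt k X, d x x' = supNorm d → T d y y' = supNorm d

namespace PeakIsometry

variable {X Y : Type*} [MetricSpace X] [MetricSpace Y] {k : ℝ}
  {T : (X → X → ℝ) → (Y → Y → ℝ)} {S : (Y → Y → ℝ) → (X → X → ℝ)}

lemma symm (h : PeakIsometry k T S) : PeakIsometry k S T where
  mapsTo := h.mapsTo_inv
  mapsTo_inv := h.mapsTo
  left_inv := h.right_inv
  right_inv := h.left_inv
  iso d hd e he := by
    rw [← h.iso _ (h.mapsTo_inv d hd) _ (h.mapsTo_inv e he), h.right_inv d hd, h.right_inv e he]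
  peak := h.peak_inv
  peak_inv := h.peak

/-- The image of `0` is `0`: unlike any other point, `0` does not lie strictly between two others. -/
lemma map_zero [Nonempty X] [Nonempty Y] (h : PeakIsometry k T S) (hk : 0 < k) (u v : Y) :
    T (fun _ _ => 0) u v = 0 := by
  have h0 := zero_mem_LPMlt (Z := X) hk
  set y := T (fun _ _ => 0) with hy
  have hyL : y ∈ LPMlt k Y := h.mapsTo _ h0
  obtain ⟨t, ht, ht1, hup⟩ := LPMlt.exists_dilate_mem hk hyL
  have hdown := LPMlt.smul_mem hk hyL (by linarith : 0 ≤ 1 - t) (by linarith)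
  have hsmall : ∀ e ∈ LPMlt k Y, (∀ a b, |e a b - y a b| ≤ t * supNorm y) →
      ∀ a b, S e a b ≤ t * supNorm y := by
    intro e he hle a b
    have h1 := LPMlt.abs_sub_le_supDist (h.mapsTo_inv e he) h0 a b
    rw [← h.iso _ (h.mapsTo_inv e he) _ h0, h.right_inv e he, ← hy, sub_zero] at h1
    exact (le_abs_self _).trans (h1.trans (supDist_le hle))
  have habs : ∀ a b, |t * y a b| ≤ t * supNorm y := fun a b => by
    rw [abs_of_nonneg (mul_nonneg ht.le (LPMlt.nonneg hyL a b))]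
    exact mul_le_mul_of_nonneg_left (LPMlt.le_supNorm hyL a b) ht.le
  have hSup := hsmall _ hup fun a b => by
    rw [show (1 + t) * y a b - y a b = t * y a b by ring]
    exact habs a b
  have hSdown := hsmall _ hdown fun a b => by
    rw [show (1 - t) * y a b - y a b = -(t * y a b) by ring, abs_neg]
    exact habs a b
  have hdist : supDist (fun a b => (1 + t) * y a b) (fun a b => (1 - t) * y a b)
      ≤ t * supNorm y := by
    rw [← h.symm.iso _ hup _ hdown]
    refine supDist_le fun a b => abs_le.2 ⟨?_, ?_⟩
    · linarith [hSdown a b, LPMlt.nonneg (h.mapsTo_inv _ hup) a b]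
    · linarith [hSup a b, LPMlt.nonneg (h.mapsTo_inv _ hdown) a b]
  have hhalf : ∀ a b, y a b ≤ supNorm y / 2 := fun a b => by
    have h1 := (le_abs_self _).trans
      ((LPMlt.abs_sub_le_supDist hup hdown a b).trans hdist)
    have h2 : t * (2 * y a b) ≤ t * supNorm y := by linarith
    linarith [le_of_mul_le_mul_left h2 ht]
  have := supNorm_le hhalf
  exact le_antisymm (by linarith [hhalf u v]) (LPMlt.nonneg hyL u v)

lemma supNorm_map [Nonempty X] [Nonempty Y] (h : PeakIsometry k T S) (hk : 0 < k)
    {d : X → X → ℝ} (hd : d ∈ LPMlt k X) : supNorm (T d) = supNorm d := by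
  have h0 : T (fun _ _ => 0) = fun _ _ => 0 := by
    funext u v
    exact h.map_zero hk u v
  rw [← LPMlt.supDist_zero hd, ← LPMlt.supDist_zero (h.mapsTo d hd),
    ← h.iso d hd _ (zero_mem_LPMlt hk), h0]

lemma exists_carries [Nonempty X] [Nonempty Y] (h : PeakIsometry k T S) (hk : 0 < k) {x x' : X}
    (hx : x ≠ x') : ∃ y y', y ≠ y' ∧ Carries k T x x' y y' := by
  obtain ⟨p, hp, hpeak, -⟩ := exists_peakAt hk hx
  obtain ⟨y, y', hy, hTpeak⟩ :=
    exists_peakAt_of_mem_Pp (h.peak p hp (hpeak.mem_Pp hk hp hx))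
  have hnorm := fun {d} hd => h.supNorm_map (d := d) hk hd
  -- comparable pseudometrics peaked at `{x, x'}` have images peaked at a common pair
  have hcmp : ∀ c ∈ LPMlt k X, ∀ d ∈ LPMlt k X, PeakAt c x x' → PeakAt d x x' →
      (∀ u v, |c u v - d u v| ≤ c x x' - d x x') →
      (T c y y' = supNorm (T c) ↔ T d y y' = supNorm (T d)) := by
    intro c hc d hd hcp hdp hle
    have hdist : supDist (T c) (T d) ≤ supNorm (T c) - supNorm (T d) := by
      rw [h.iso c hc d hd, hnorm hc, hnorm hd, ← hcp.1, ← hdp.1]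
      exact supDist_le hle
    exact ⟨attains_of_supDist_le (h.mapsTo c hc) (h.mapsTo d hd) hdist,
      attains_of_supDist_le_of_mem_Pp (h.mapsTo c hc) (h.mapsTo d hd) hdist
        (h.peak c hc (hcp.mem_Pp hk hc hx)) (h.peak d hd (hdp.mem_Pp hk hd hx)) hy⟩
  have hpk : ∀ q ∈ LPMlt k X, PeakAt q x x' → T q y y' = supNorm q := by
    intro q hq hqpeak
    have half_pos : (0 : ℝ) < 1 / 2 := by norm_num
    have half_le : (1 / 2 : ℝ) ≤ 1 := by norm_num
    have halves : (1 / 2 : ℝ) + 1 / 2 ≤ 1 := by norm_num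
    have hscale : ∀ r ∈ LPMlt k X, PeakAt r x x' → ∀ u v,
        |r u v - 1 / 2 * r u v| ≤ r x x' - 1 / 2 * r x x' := by
      intro r hr hrp u v
      have h1 := LPMlt.nonneg hr u v
      have h2 := LPMlt.le_supNorm hr u v
      rw [← hrp.1] at h2
      exact abs_le.2 ⟨by linarith, by linarith⟩
    have hsum : ∀ r ∈ LPMlt k X, PeakAt r x x' → ∀ e : X → X → ℝ, ∀ u v,
        |1 / 2 * r u v + 1 / 2 * e u v - 1 / 2 * e u v| ≤
          1 / 2 * r x x' + 1 / 2 * e x x' - 1 / 2 * e x x' := by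
      intro r hr hrp e u v
      have h1 := LPMlt.nonneg hr u v
      have h2 := LPMlt.le_supNorm hr u v
      rw [← hrp.1] at h2
      exact abs_le.2 ⟨by linarith, by linarith⟩
    have hp2 := LPMlt.smul_mem hk hp half_pos.le half_le
    have hq2 := LPMlt.smul_mem hk hq half_pos.le half_le
    have hm := LPMlt.convex hk hq hp half_pos.le half_pos.le halves
    have hpp := hpeak.const_mul hk hp half_pos half_le
    have hqp := hqpeak.const_mul hk hq half_pos half_le
    have hmp := hpeak.convex hk hp hq hqpeak.1 half_pos.le half_pos halves
    have h1 := (hcmp _ hp _ hp2 hpeak hpp (hscale p hp hpeak)).1 hTpeak.1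
    have h2 := (hcmp _ hm _ hp2 hmp hpp (hsum q hq hqpeak p)).2 h1
    have h3 := (hcmp _ hm _ hq2 hmp hqp fun u v => by
      simpa only [add_comm (1 / 2 * q _ _)] using hsum p hp hpeak q u v).1 h2
    rw [← hnorm hq]
    exact (hcmp _ hq _ hq2 hqpeak hqp (hscale q hq hqpeak)).2 h3
  refine ⟨y, y', hy, fun e he hatt => ?_⟩
  refine le_antisymm (hnorm he ▸ LPMlt.le_supNorm (h.mapsTo e he) y y') ?_
  refine le_of_forall_pos_le_add fun ε hε => ?_
  set C := supNorm e + supNorm p with hC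
  have hC0 : 0 ≤ C :=
    add_nonneg (hatt ▸ LPMlt.nonneg he x x') (hpeak.1 ▸ LPMlt.nonneg hp x x')
  have ht : 0 < min 1 (ε / (2 * (C + 1))) := lt_min one_pos (by positivity)
  set t := min 1 (ε / (2 * (C + 1))) with htdef
  have ht1 : t ≤ 1 := min_le_left _ _
  have htC : 2 * (t * C) ≤ ε := by
    have h1 : t * (2 * (C + 1)) ≤ ε :=
      (le_div_iff₀ (by positivity)).1 (min_le_right 1 (ε / (2 * (C + 1))))
    linarith
  have hst : 1 - t + t ≤ 1 := by linarith
  have hs : 0 ≤ 1 - t := by linarith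
  have hm := LPMlt.convex hk he hp hs ht.le hst
  have hmp := hpeak.convex hk hp he hatt hs ht hst
  have h1 := hpk _ hm hmp
  rw [← hmp.1] at h1
  beta_reduce at h1
  rw [hatt, hpeak.1] at h1
  have h2 := (neg_le_abs _).trans (LPMlt.abs_sub_le_supDist (h.mapsTo e he) (h.mapsTo _ hm) y y')
  rw [h.iso e he _ hm, h1] at h2
  have h3 : supDist e (fun u v => (1 - t) * e u v + t * p u v) ≤ t * C := by
    refine supDist_le fun u v => ?_
    have a1 := LPMlt.le_supNorm he u v
    have a2 := LPMlt.le_supNorm hp u v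
    have a3 := LPMlt.nonneg he u v
    have a4 := LPMlt.nonneg hp u v
    rw [show e u v - ((1 - t) * e u v + t * p u v) = t * (e u v - p u v) by ring, abs_mul,
      abs_of_pos ht]
    exact mul_le_mul_of_nonneg_left (abs_le.2 ⟨by linarith, by linarith⟩) ht.le
  have h4 : 0 ≤ t * supNorm p := mul_nonneg ht.le (hpeak.1 ▸ LPMlt.nonneg hp x x')
  rw [hC] at htC h3
  linarith

/-- Each pair of points of `X` corresponds to a pair of points of `Y`. -/
lemma exists_carries_both [Nonempty X] [Nonempty Y] (h : PeakIsometry k T S) (hk : 0 < k)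
    {x x' : X} (hx : x ≠ x') :
    ∃ y y', y ≠ y' ∧ Carries k T x x' y y' ∧ Carries k S y y' x x' := by
  obtain ⟨y, y', hy, hT⟩ := h.exists_carries hk hx
  obtain ⟨u, u', hu, hS⟩ := h.symm.exists_carries hk hy
  refine ⟨y, y', hy, hT, fun e he hatt => ?_⟩
  obtain ⟨p, hp, hpeak, -⟩ := exists_peakAt hk hx
  have hnorm := h.supNorm_map hk hp
  have h1 := hS (T p) (h.mapsTo p hp) (by rw [hnorm]; exact hT p hp hpeak.1)
  rw [h.left_inv p hp, hnorm] at h1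
  have h2 := hpeak.2 u u' hu h1
  have h3 := hS e he hatt
  rcases Set.pair_eq_pair_iff.1 h2 with ⟨rfl, rfl⟩ | ⟨rfl, rfl⟩
  · exact h3
  · rw [(LPMlt.isPseudometric (h.mapsTo_inv e he)).2.1, h3]

lemma dist_le_of_carries (h : PeakIsometry k T S) (hk : 0 < k) {x x' : X} {y y' : Y}
    (hT : Carries k T x x' y y') : dist x x' ≤ dist y y' := by
  have : Nonempty X := ⟨x⟩
  by_contra! hlt
  have hpos : 0 < dist x x' := dist_nonneg.trans_lt hlt
  set l := k * dist y y' / dist x x' with hl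
  have hl0 : 0 ≤ l := by positivity
  have hlk : l < k := by
    rw [hl, div_lt_iff₀ hpos]
    exact mul_lt_mul_of_pos_left hlt hk
  set m := (l + k) / 2 with hm
  have hc0 : 0 ≤ m * dist x x' := mul_nonneg (by linarith) hpos.le
  have he := LPMlt.min_add_mem (Z := X) hk (zero_mem_LPMlt hk) hc0 (l := m) (by linarith)
    (by linarith) (fun a b => mul_nonneg (by linarith) dist_nonneg)
  have hval : min (0 + m * dist x x') (m * dist x x') = m * dist x x' := by simp
  have h1 := hT _ he (le_antisymm (LPMlt.le_supNorm he x x')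
    (supNorm_le fun a b => by
      rw [hval]
      exact (min_le_left _ _).trans (by simp)))
  have h2 := LPMlt.le_mul_dist hk (h.mapsTo _ he) y y'
  have h3 := LPMlt.le_supNorm he x x'
  have h4 : l * dist x x' = k * dist y y' := by rw [hl]; field_simp
  have h5 : l * dist x x' < m * dist x x' := mul_lt_mul_of_pos_right (by linarith) hpos
  rw [hval] at h3
  linarith

/-- Comparison with a raised pseudometric. -/
lemma map_le_add_of_lt (h : PeakIsometry k T S) (hk : 0 < k) {x x' : X} {y y' : Y}
    (hx : x ≠ x') (hT : Carries k T x x' y y') {c ε : ℝ} (hc : 0 ≤ c) (hε : 0 < ε)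
    (hind : ∀ e ∈ LPMlt k X, supNorm e ≤ c → T e y y' = e x x') {d : X → X → ℝ}
    (hd : d ∈ LPMlt k X) (hdc : supNorm d ≤ c + ε) (hlt : d x x' + ε < k * dist x x') :
    d x x' ≤ T d y y' ∧ T d y y' ≤ d x x' + 2 * ε := by
  have : Nonempty X := ⟨x⟩
  have hpos : 0 < dist x x' := dist_pos.2 hx
  have hdn := LPMlt.nonneg hd
  obtain ⟨-, -, K, hK0, hK, hKl⟩ := (mem_LPMlt_iff hk).1 hd
  set s := d x x' + ε with hs
  set l := max K (s / dist x x') with hl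
  have hlk : l < k := max_lt hK ((div_lt_iff₀ hpos).2 hlt)
  have hdl : ∀ a b, d a b ≤ l * dist a b := fun a b =>
    (hKl a b).trans (mul_le_mul_of_nonneg_right (le_max_left _ _) dist_nonneg)
  have hsl : s ≤ l * dist x x' := (div_le_iff₀ hpos).1 (le_max_right _ _)
  have hq := LPMlt.min_add_mem hk hd hε.le (hK0.trans (le_max_left _ _)) hlk hdl
  have he := LPMlt.min_const_mem hk hq (hc.trans (le_max_left c s))
  set e : X → X → ℝ := fun a b => min (min (d a b + ε) (l * dist a b)) (max c s) with hedef
  have hval : e x x' = s := by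
    simp only [hedef]
    rw [min_eq_left hsl, min_eq_left (le_max_right _ _)]
  have hTe : T e y y' = s := by
    rcases le_total s c with hsc | hsc
    · rw [hind e he (supNorm_le fun a b => (min_le_right _ _).trans (max_eq_left hsc).le), hval]
    · have hn : supNorm e = s := le_antisymm
        (supNorm_le fun a b => (min_le_right _ _).trans (max_eq_right hsc).le)
        (hval ▸ LPMlt.le_supNorm he x x')
      rw [hT e he (hval.trans hn.symm), hn]
  have hdist : supDist d e ≤ ε := by
    refine supDist_le fun a b => abs_le.2 ⟨?_, ?_⟩
    · have : e a b ≤ d a b + ε := (min_le_left _ _).trans (min_le_left _ _)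
      linarith
    · have h1 := LPMlt.le_supNorm hd a b
      have : d a b - ε ≤ e a b := le_min
        (le_min (by linarith) (by linarith [hdl a b]))
        ((by linarith : d a b - ε ≤ c).trans (le_max_left _ _))
      linarith
  have h1 := LPMlt.abs_sub_le_supDist (h.mapsTo d hd) (h.mapsTo e he) y y'
  rw [h.iso d hd e he, hTe] at h1
  have h2 := abs_le.1 (h1.trans hdist)
  constructor <;> linarith [h2.1, h2.2]

/-- Comparison with a lowered pseudometric. -/
lemma sub_le_map_of_le (h : PeakIsometry k T S) (hk : 0 < k) {x x' : X} {y y' : Y}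
    {c ε : ℝ} (hc : 0 ≤ c) (hε : 0 < ε)
    (hind : ∀ e ∈ LPMlt k X, supNorm e ≤ c → T e y y' = e x x') {d : X → X → ℝ}
    (hd : d ∈ LPMlt k X) (hdc : supNorm d ≤ c + ε) (hle : ε ≤ d x x') :
    d x x' - 2 * ε ≤ T d y y' ∧ T d y y' ≤ d x x' := by
  have : Nonempty X := ⟨x⟩
  have hdp := LPMlt.isPseudometric hd
  have hl0 : 0 ≤ d x x' - ε := by linarith
  have he := LPMlt.min_const_mem hk (LPMlt.shortcut_mem hk hd x x' hl0) hc
  set e : X → X → ℝ := fun a b => min (shortcut d x x' (d x x' - ε) a b) c with hedef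
  have hlow : ∀ a b, d a b - ε ≤ e a b := by
    intro a b
    have h1 := LPMlt.le_supNorm hd a b
    have t1 := hdp.2.2 a x b
    have t2 := hdp.2.2 x x' b
    have t3 := hdp.2.2 a x' b
    have t4 := hdp.2.2 x' x b
    have s1 := hdp.2.1 x x'
    exact le_min (le_min (by linarith) (le_min (by linarith) (by linarith))) (by linarith)
  have hup : ∀ a b, e a b ≤ d a b := fun a b => (min_le_left _ _).trans (min_le_left _ _)
  have hval : e x x' = d x x' - ε := by
    refine le_antisymm ?_ (hlow x x')
    refine (min_le_left _ _).trans ((min_le_right _ _).trans ((min_le_left _ _).trans ?_))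
    simp [hdp.1]
  have hTe := hind e he (supNorm_le fun a b => min_le_right _ _)
  have hdist : supDist d e ≤ ε :=
    supDist_le fun a b => abs_le.2 ⟨by linarith [hup a b], by linarith [hlow a b]⟩
  have h1 := LPMlt.abs_sub_le_supDist (h.mapsTo d hd) (h.mapsTo e he) y y'
  rw [h.iso d hd e he, hTe, hval] at h1
  have h2 := abs_le.1 (h1.trans hdist)
  constructor <;> linarith [h2.1, h2.2]

/-- Corresponding pairs have the same values under every Lipschitz pseudometric. -/
lemma map_eq_of_carries (h : PeakIsometry k T S) (hk : 0 < k) {x x' : X} {y y' : Y}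
    (hx : x ≠ x') (hy : y ≠ y') (hT : Carries k T x x' y y') (hS : Carries k S y y' x x')
    {d : X → X → ℝ} (hd : d ∈ LPMlt k X) : T d y y' = d x x' := by
  have : Nonempty X := ⟨x⟩
  have : Nonempty Y := ⟨y⟩
  have hdist : dist x x' = dist y y' :=
    le_antisymm (h.dist_le_of_carries hk hT) (h.symm.dist_le_of_carries hk hS)
  have hpos : 0 < dist x x' := dist_pos.2 hx
  obtain ⟨ε, hε⟩ : ∃ ε, k * dist x x' = 4 * ε := ⟨k * dist x x' / 4, by ring⟩
  have hε0 : 0 < ε := by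
    have := mul_pos hk hpos
    linarith
  have main : ∀ n : ℕ, ∀ d ∈ LPMlt k X, supNorm d ≤ n * ε → T d y y' = d x x' := by
    intro n
    induction n with
    | zero =>
      intro d hd hn
      simp only [Nat.cast_zero, zero_mul] at hn
      have h1 := LPMlt.le_supNorm hd x x'
      have h2 := LPMlt.le_supNorm (h.mapsTo d hd) y y'
      rw [h.supNorm_map hk hd] at h2
      linarith [LPMlt.nonneg hd x x', LPMlt.nonneg (h.mapsTo d hd) y y']
    | succ n ih =>
      intro d hd hn
      push_cast at hn
      have hn' : supNorm d ≤ n * ε + ε := by linarith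
      have hc : 0 ≤ n * ε := by positivity
      have ih' : ∀ e ∈ LPMlt k Y, supNorm e ≤ n * ε → S e x x' = e y y' := by
        intro e he hen
        have h1 := ih (S e) (h.mapsTo_inv e he) (by rwa [h.symm.supNorm_map hk he])
        rw [← h1, h.right_inv e he]
      have hTd := h.mapsTo d hd
      have hTn : supNorm (T d) ≤ n * ε + ε := by rwa [h.supNorm_map hk hd]
      have L := fun hlt => h.map_le_add_of_lt hk hx hT hc hε0 ih hd hn' hlt
      have U := fun hle => h.sub_le_map_of_le hk hc hε0 ih hd hn' hle
      have L' := fun hlt => h.symm.map_le_add_of_lt hk hy hS hc hε0 ih' hTd hTn hlt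
      have U' := fun hle => h.symm.sub_le_map_of_le hk hc hε0 ih' hTd hTn hle
      rw [hε] at L
      rw [← hdist, hε, h.left_inv d hd] at L'
      rw [h.left_inv d hd] at U'
      rcases lt_or_ge (d x x') ε with h1 | h1
      · have l := L (by linarith)
        have l' := L' (by linarith)
        linarith
      · have u := U h1
        rcases lt_or_ge (d x x') (3 * ε) with h2 | h2
        · have l := L (by linarith)
          linarith
        · have u' := U' (by linarith)
          linarith
  obtain ⟨n, hn⟩ := exists_nat_ge (supNorm d / ε)
  exact main n d hd ((div_le_iff₀ hε0).1 hn)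

lemma exists_corresponding [Nonempty X] [Nonempty Y] (h : PeakIsometry k T S) (hk : 0 < k)
    {x x' : X} (hx : x ≠ x') :
    ∃ y y', y ≠ y' ∧ ∀ d ∈ LPMlt k X, T d y y' = d x x' := by
  obtain ⟨y, y', hy, hT, hS⟩ := h.exists_carries_both hk hx
  exact ⟨y, y', hy, fun d hd => h.map_eq_of_carries hk hx hy hT hS hd⟩

/-- The two remaining sides of a triangle correspond to the two remaining sides of a triangle. -/
lemma exists_apex [Nonempty X] [Nonempty Y] (h : PeakIsometry k T S) (hk : 0 < k) {a b c : X}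
    (hab : a ≠ b) (hac : a ≠ c) (hbc : b ≠ c) {u v : Y} (huv : u ≠ v)
    (huvT : ∀ d ∈ LPMlt k X, T d u v = d a b) :
    ∃ t, t ≠ u ∧ t ≠ v ∧
      ((∀ d ∈ LPMlt k X, T d u t = d a c) ∧ (∀ d ∈ LPMlt k X, T d v t = d b c) ∨
       (∀ d ∈ LPMlt k X, T d v t = d a c) ∧ (∀ d ∈ LPMlt k X, T d u t = d b c)) := by
  obtain ⟨p, q, hpq, hpqT⟩ := h.exists_corresponding hk hac
  obtain ⟨r, s, hrs, hrsT⟩ := h.exists_corresponding hk hbc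
  have hTsymm : ∀ d ∈ LPMlt k X, ∀ m n, T d m n = T d n m := fun d hd =>
    (LPMlt.isPseudometric (h.mapsTo d hd)).2.1
  have hne1 : ¬ (u = p ∧ v = q ∨ u = q ∧ v = p) := by
    intro hor
    have := pair_eq_of_forall_eq hk hac (u := a) (v := b) fun d hd => by
      rw [← huvT d hd, ← hpqT d hd]
      rcases hor with ⟨rfl, rfl⟩ | ⟨rfl, rfl⟩
      · rfl
      · exact hTsymm d hd _ _
    grind
  have hne2 : ¬ (u = r ∧ v = s ∨ u = s ∧ v = r) := by
    intro hor
    have := pair_eq_of_forall_eq hk hbc (u := a) (v := b) fun d hd => by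
      rw [← huvT d hd, ← hrsT d hd]
      rcases hor with ⟨rfl, rfl⟩ | ⟨rfl, rfl⟩
      · rfl
      · exact hTsymm d hd _ _
    grind
  -- a pseudometric vanishing exactly on the classes generated by `p ~ q` and `r ~ s`
  have he0 := LPMlt.min_add_mem (Z := Y) hk (zero_mem_LPMlt hk) (ε := 1) one_pos.le
    (l := k / 2) (by linarith) (by linarith) (fun m n => mul_nonneg (by linarith) dist_nonneg)
  set e0 : Y → Y → ℝ := fun m n => min (0 + 1) (k / 2 * dist m n) with he0def
  have he0z : ∀ m n, e0 m n ≤ 0 → m = n := by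
    intro m n hmn
    rcases min_le_iff.1 hmn with h1 | h1
    · norm_num at h1
    · exact dist_le_zero.1 (nonpos_of_mul_nonpos_right h1 (by linarith))
  have he1 := LPMlt.shortcut_mem hk he0 p q le_rfl
  set e1 := shortcut e0 p q 0 with he1def
  have he1z : ∀ m n, e1 m n ≤ 0 → m = n ∨ m = p ∧ n = q ∨ m = q ∧ n = p := by
    intro m n hmn
    have n1 := LPMlt.nonneg he0
    rcases min_le_iff.1 hmn with h1 | h1
    · exact Or.inl (he0z _ _ h1)
    · rcases min_le_iff.1 h1 with h2 | h2
      · exact Or.inr (Or.inl ⟨he0z _ _ (by linarith [n1 m p, n1 q n]),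
          (he0z _ _ (by linarith [n1 m p, n1 q n])).symm⟩)
      · exact Or.inr (Or.inr ⟨he0z _ _ (by linarith [n1 m q, n1 p n]),
          (he0z _ _ (by linarith [n1 m q, n1 p n])).symm⟩)
  have he2 := LPMlt.shortcut_mem hk he1 r s le_rfl
  set e2 := shortcut e1 r s 0 with he2def
  have e1pq : e1 p q ≤ 0 := by
    refine (min_le_right _ _).trans ((min_le_left _ _).trans ?_)
    simp [(LPMlt.isPseudometric he0).1]
  have e2pq : e2 p q ≤ 0 := (min_le_left _ _).trans e1pq
  have e2rs : e2 r s ≤ 0 := by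
    refine (min_le_right _ _).trans ((min_le_left _ _).trans ?_)
    simp [(LPMlt.isPseudometric he1).1]
  have hSe := h.mapsTo_inv e2 he2
  have htri := (LPMlt.isPseudometric hSe).2.2 a c b
  rw [(LPMlt.isPseudometric hSe).2.1 c b, ← huvT _ hSe, ← hpqT _ hSe, ← hrsT _ hSe,
    h.right_inv e2 he2] at htri
  have huv0 : e2 u v ≤ 0 := by linarith
  have hpath : (∃ t, t ≠ u ∧ t ≠ v ∧
      ((u = p ∧ t = q ∨ u = q ∧ t = p) ∧ (v = r ∧ t = s ∨ v = s ∧ t = r) ∨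
       (v = p ∧ t = q ∨ v = q ∧ t = p) ∧ (u = r ∧ t = s ∨ u = s ∧ t = r))) := by
    have n1 := LPMlt.nonneg he1
    rcases min_le_iff.1 huv0 with h1 | h1
    · exact ((he1z _ _ h1).elim huv hne1).elim
    · rcases min_le_iff.1 h1 with h2 | h2
      · have h3 := he1z _ _ (by linarith [n1 u r, n1 s v] : e1 u r ≤ 0)
        have h4 := he1z _ _ (by linarith [n1 u r, n1 s v] : e1 s v ≤ 0)
        exact exists_common_vertex huv hne1 hne2 h3 h4
      · have h3 := he1z _ _ (by linarith [n1 u s, n1 r v] : e1 u s ≤ 0)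
        have h4 := he1z _ _ (by linarith [n1 u s, n1 r v] : e1 r v ≤ 0)
        obtain ⟨t, htu, htv, ht⟩ := exists_common_vertex huv hne1 (mt Or.symm hne2) h3 h4
        exact ⟨t, htu, htv, ht.imp (And.imp_right Or.symm) (And.imp_right Or.symm)⟩
  have hswap : ∀ {m n m' n' : Y} {w w' : X}, (m = m' ∧ n = n' ∨ m = n' ∧ n = m') →
      (∀ d ∈ LPMlt k X, T d m' n' = d w w') → ∀ d ∈ LPMlt k X, T d m n = d w w' := by
    rintro m n m' n' w w' (⟨rfl, rfl⟩ | ⟨rfl, rfl⟩) hR d hd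
    · exact hR d hd
    · rw [hTsymm d hd, hR d hd]
  obtain ⟨t, htu, htv, hor⟩ := hpath
  refine ⟨t, htu, htv, hor.imp ?_ ?_⟩
  · rintro ⟨h1, h2⟩
    exact ⟨hswap h1 hpqT, hswap h2 hrsT⟩
  · rintro ⟨h1, h2⟩
    exact ⟨hswap h1 hpqT, hswap h2 hrsT⟩

end PeakIsometry

/-! ### From a correspondence of pairs to a bijection of points -/

lemma exists_third {X : Type*} (h : ¬ ExactlyTwo X) {a b : X} (hab : a ≠ b) :
    ∃ c, a ≠ c ∧ b ≠ c := by
  by_contra! hc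
  refine h ⟨a, b, hab, fun c => ?_⟩
  by_cases hac : a = c
  · exact Or.inl hac.symm
  · exact Or.inr (hc c hac).symm

/-- A bijective correspondence between pairs of points which maps triangles to triangles is
induced by a bijection of points. -/
lemma exists_equiv_of_pair_correspondence {X Y : Type*} [Nontrivial X] [Nontrivial Y]
    {R : X → X → Y → Y → Prop}
    (symm_left : ∀ {a b u v}, R a b u v → R b a u v)
    (symm_right : ∀ {a b u v}, R a b u v → R a b v u)
    (exists_right : ∀ {a b}, a ≠ b → ∃ u v, u ≠ v ∧ R a b u v)
    (exists_left : ∀ {u v}, u ≠ v → ∃ a b, a ≠ b ∧ R a b u v)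
    (right_unique : ∀ {a b u v u' v'}, u' ≠ v' → R a b u v → R a b u' v' →
      u = u' ∧ v = v' ∨ u = v' ∧ v = u')
    (left_unique : ∀ {a b a' b' u v}, a' ≠ b' → R a b u v → R a' b' u v →
      a = a' ∧ b = b' ∨ a = b' ∧ b = a')
    (triangle : ∀ {a b c u v}, a ≠ b → a ≠ c → b ≠ c → u ≠ v → R a b u v →
      ∃ t, t ≠ u ∧ t ≠ v ∧ (R a c u t ∧ R b c v t ∨ R a c v t ∧ R b c u t)) :
    ∃ ψ : X ≃ Y, ∀ a b, a ≠ b → R a b (ψ a) (ψ b) := by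
  classical
  by_cases h2 : ExactlyTwo X
  · obtain ⟨a, b, hab, hX⟩ := h2
    obtain ⟨u, v, huv, hR⟩ := exists_right hab
    have hY : ∀ y, y = u ∨ y = v := by
      intro y
      by_contra! hy
      obtain ⟨a', b', hab', hR'⟩ := exists_left hy.1
      have hR'' : R a b y u := by
        rcases hX a' with rfl | rfl <;> rcases hX b' with rfl | rfl
        · exact absurd rfl hab'
        · exact hR'
        · exact symm_left hR'
        · exact absurd rfl hab'
      have := right_unique huv hR'' hR
      grind
    let ψ : X → Y := fun x => if x = a then u else v
    have ha : ψ a = u := if_pos rfl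
    have hb : ψ b = v := if_neg hab.symm
    have hbij : Function.Bijective ψ := by
      constructor
      · intro m n hmn
        rcases hX m with rfl | rfl <;> rcases hX n with rfl | rfl <;> simp_all
      · intro y
        rcases hY y with rfl | rfl
        · exact ⟨a, ha⟩
        · exact ⟨b, hb⟩
    refine ⟨Equiv.ofBijective ψ hbij, fun m n hmn => ?_⟩
    rw [Equiv.ofBijective_apply, Equiv.ofBijective_apply]
    rcases hX m with rfl | rfl <;> rcases hX n with rfl | rfl
    · exact absurd rfl hmn
    · rwa [ha, hb]
    · rw [ha, hb]
      exact symm_left (symm_right hR)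
    · exact absurd rfl hmn
  · have hpoint : ∀ a : X, ∃ y : Y, ∀ b, a ≠ b → ∃ v, y ≠ v ∧ R a b y v := by
      intro a
      obtain ⟨b, hba⟩ := exists_ne a
      have hab := hba.symm
      obtain ⟨c, hac, hbc⟩ := exists_third h2 hab
      have hwlog : ∃ u v t, u ≠ v ∧ t ≠ u ∧ t ≠ v ∧ R a b u v ∧ R a c u t ∧ R b c v t := by
        obtain ⟨u, v, huv, hR⟩ := exists_right hab
        obtain ⟨t, htu, htv, ⟨h1, h3⟩ | ⟨h1, h3⟩⟩ := triangle hab hac hbc huv hR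
        · exact ⟨u, v, t, huv, htu, htv, hR, h1, h3⟩
        · exact ⟨v, u, t, huv.symm, htv, htu, symm_right hR, h1, h3⟩
      obtain ⟨u, v, t, huv, htu, htv, hRab, hRac, hRbc⟩ := hwlog
      refine ⟨u, fun e hae => ?_⟩
      by_cases hbe : b = e
      · exact hbe ▸ ⟨v, huv, hRab⟩
      by_cases hce : c = e
      · exact hce ▸ ⟨t, htu.symm, hRac⟩
      obtain ⟨t', ht'u, ht'v, ⟨h1, -⟩ | ⟨h1, -⟩⟩ := triangle hab hae hbe huv hRab
      · exact ⟨t', ht'u.symm, h1⟩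
      obtain ⟨s, hsu, hst, ⟨h3, -⟩ | ⟨h3, -⟩⟩ := triangle hac hae hce htu.symm hRac
      · exact ⟨s, hsu.symm, h3⟩
      exfalso
      rcases right_unique hst.symm h1 h3 with ⟨hvt, -⟩ | ⟨-, htt⟩
      · exact htv hvt.symm
      · rw [htt] at h1
        have := left_unique hbc h1 hRbc
        grind
    choose ψ hψ using hpoint
    have hinj : Function.Injective ψ := by
      intro a b hψab
      by_contra hab
      obtain ⟨c, hac, hbc⟩ := exists_third h2 hab
      obtain ⟨v, hv, hR⟩ := hψ a b hab
      obtain ⟨t1, ht1, hR1⟩ := hψ a c hac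
      obtain ⟨t2, ht2, hR2⟩ := hψ b c hbc
      obtain ⟨t, htu, htv, ⟨-, h3⟩ | ⟨h3, -⟩⟩ := triangle hab hac hbc hv hR
      · have := right_unique ht2 h3 hR2
        grind
      · have := right_unique ht1 h3 hR1
        grind
    have hR : ∀ a b, a ≠ b → R a b (ψ a) (ψ b) := by
      intro a b hab
      obtain ⟨v, hv, h1⟩ := hψ a b hab
      obtain ⟨v', hv', h3⟩ := hψ b a hab.symm
      rcases right_unique hv' h1 (symm_left h3) with ⟨h4, -⟩ | ⟨-, h4⟩
      · exact absurd (hinj h4) hab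
      · exact h4 ▸ h1
    have hsurj : Function.Surjective ψ := by
      intro y
      obtain ⟨y', hy⟩ := exists_ne y
      obtain ⟨a, b, hab, h1⟩ := exists_left hy.symm
      rcases right_unique (hinj.ne hab) h1 (hR a b hab) with ⟨h3, -⟩ | ⟨h3, -⟩
      · exact ⟨a, h3.symm⟩
      · exact ⟨b, h3.symm⟩
    exact ⟨Equiv.ofBijective ψ ⟨hinj, hsurj⟩, hR⟩

/-- A bounded metric scaled by half the bound lies in `LPMlt k Z`. -/
lemma half_mul_dist_mem_LPMlt {Z : Type*} [MetricSpace Z] (hZ : ∃ C : ℝ, ∀ a b : Z, dist a b ≤ C)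
    {k : ℝ} (hk : 0 < k) : (fun a b : Z => k / 2 * dist a b) ∈ LPMlt k Z := by
  obtain ⟨C, hC⟩ := hZ
  refine (mem_LPMlt_iff hk).2 ⟨⟨by simp, fun z w => by simp only [dist_comm], fun z w v => ?_⟩,
    ⟨k / 2 * C, fun z w => mul_le_mul_of_nonneg_left (hC z w) (by positivity)⟩,
    k / 2, by positivity, by linarith, fun _ _ => le_rfl⟩
  rw [← mul_add]
  exact mul_le_mul_of_nonneg_left (dist_triangle z w v) (by positivity)

lemma PeakIsometry.exists_homeomorph {X Y : Type*} [MetricSpace X] [MetricSpace Y]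
    [Nontrivial X] [Nontrivial Y] {k : ℝ} {T : (X → X → ℝ) → (Y → Y → ℝ)}
    {S : (Y → Y → ℝ) → (X → X → ℝ)} (h : PeakIsometry k T S) (hk : 0 < k)
    (hX : ∃ C : ℝ, ∀ a b : X, dist a b ≤ C) (hY : ∃ C : ℝ, ∀ a b : Y, dist a b ≤ C) :
    ∃ φ : Y ≃ₜ X, ∀ d ∈ LPMlt k X, ∀ x y : Y, T d x y = d (φ x) (φ y) := by
  obtain ⟨ψ, hψ⟩ := exists_equiv_of_pair_correspondence (X := X) (Y := Y)
    (R := fun a b u v => ∀ d ∈ LPMlt k X, T d u v = d a b)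
    (fun hR d hd => by rw [hR d hd, (LPMlt.isPseudometric hd).2.1])
    (fun hR d hd => by rw [(LPMlt.isPseudometric (h.mapsTo d hd)).2.1, hR d hd])
    (fun hab => h.exists_corresponding hk hab)
    (fun huv => by
      obtain ⟨a, b, hab, hR⟩ := h.symm.exists_corresponding hk huv
      refine ⟨a, b, hab, fun d hd => ?_⟩
      rw [← hR _ (h.mapsTo d hd), h.left_inv d hd])
    (fun huv hR hR' => pair_eq_of_forall_eq hk huv fun e he => by
      rw [← h.right_inv e he, hR _ (h.mapsTo_inv e he), hR' _ (h.mapsTo_inv e he)])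
    (fun hab hR hR' => pair_eq_of_forall_eq hk hab fun d hd => by
      rw [← hR d hd, hR' d hd])
    (fun hab hac hbc huv hR => h.exists_apex hk hab hac hbc huv hR)
  have hval : ∀ d ∈ LPMlt k X, ∀ a b, T d (ψ a) (ψ b) = d a b := by
    intro d hd a b
    rcases eq_or_ne a b with rfl | hab
    · rw [(LPMlt.isPseudometric hd).1, (LPMlt.isPseudometric (h.mapsTo d hd)).1]
    · exact hψ a b hab d hd
  have hψdist : ∀ a b, dist (ψ a) (ψ b) ≤ 2 * dist a b := by
    intro a b
    have he := half_mul_dist_mem_LPMlt hY hk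
    have h1 := LPMlt.le_mul_dist hk (h.mapsTo_inv _ he) a b
    rw [← hval _ (h.mapsTo_inv _ he), h.right_inv _ he] at h1
    exact le_of_mul_le_mul_left (by linarith) hk
  have hψdist' : ∀ a b, dist a b ≤ 2 * dist (ψ a) (ψ b) := by
    intro a b
    have hd := half_mul_dist_mem_LPMlt hX hk
    have h1 := LPMlt.le_mul_dist hk (h.mapsTo _ hd) (ψ a) (ψ b)
    rw [hval _ hd] at h1
    exact le_of_mul_le_mul_left (by linarith) hk
  have hcont : Continuous ψ := (LipschitzWith.of_dist_le_mul (K := 2) hψdist).continuous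
  have hcont' : Continuous ψ.symm :=
    (LipschitzWith.of_dist_le_mul (K := 2) fun u v => by
      simpa using hψdist' (ψ.symm u) (ψ.symm v)).continuous
  refine ⟨⟨ψ.symm, hcont', hcont⟩, fun d hd x y => ?_⟩
  have := hval d hd (ψ.symm x) (ψ.symm y)
  simpa using this

lemma homeomorph_unique {X Y : Type*} [MetricSpace X] [MetricSpace Y] [Nontrivial Y] {k : ℝ}
    (hk : 0 < k) (hY : ¬ ExactlyTwo Y) {T : (X → X → ℝ) → (Y → Y → ℝ)} {φ₁ φ₂ : Y ≃ₜ X}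
    (h₁ : ∀ d ∈ LPMlt k X, ∀ x y : Y, T d x y = d (φ₁ x) (φ₁ y))
    (h₂ : ∀ d ∈ LPMlt k X, ∀ x y : Y, T d x y = d (φ₂ x) (φ₂ y)) (y : Y) : φ₁ y = φ₂ y := by
  obtain ⟨a, hay⟩ := exists_ne y
  obtain ⟨b, hyb, hab⟩ := exists_third hY hay.symm
  have key : ∀ c, y ≠ c → φ₁ y = φ₂ y ∨ φ₁ y = φ₂ c := fun c hc =>
    (pair_eq_of_forall_eq hk (φ₂.injective.ne hc) fun d hd => by
      rw [← h₁ d hd, ← h₂ d hd]).imp And.left And.left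
  rcases key a hay.symm with h3 | h3
  · exact h3
  rcases key b hyb with h4 | h4
  · exact h4
  exact absurd (φ₂.injective (h3.symm.trans h4)) hab

theorem stmt16 {X Y : Type*} [MetricSpace X] [MetricSpace Y]
    [Nontrivial X] [Nontrivial Y]
    (hX : ∃ C : ℝ, ∀ a b : X, dist a b ≤ C) (hY : ∃ C : ℝ, ∀ a b : Y, dist a b ≤ C)
    (k : ℝ) (hk : 0 < k)
    (T : (X → X → ℝ) → (Y → Y → ℝ))
    (hbij : Set.BijOn T (LPMlt k X) (LPMlt k Y))
    (hiso : ∀ d ∈ LPMlt k X, ∀ e ∈ LPMlt k X, supDist (T d) (T e) = supDist d e)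
    (hPp : T '' (Pp X ∩ LPMlt k X) = Pp Y ∩ LPMlt k Y) :
    (∃ φ : Y ≃ₜ X, ∀ d ∈ LPMlt k X, ∀ x y : Y, T d x y = d (φ x) (φ y)) ∧
    (¬ ExactlyTwo X → ¬ ExactlyTwo Y →
      ∀ φ₁ φ₂ : Y ≃ₜ X,
        (∀ d ∈ LPMlt k X, ∀ x y : Y, T d x y = d (φ₁ x) (φ₁ y)) →
        (∀ d ∈ LPMlt k X, ∀ x y : Y, T d x y = d (φ₂ x) (φ₂ y)) →
        ∀ y : Y, φ₁ y = φ₂ y) := by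
  have hinv : ∀ d ∈ LPMlt k X, Function.invFunOn T (LPMlt k X) (T d) = d := fun d hd =>
    hbij.injOn.leftInvOn_invFunOn hd
  have h : PeakIsometry k T (Function.invFunOn T (LPMlt k X)) :=
    { mapsTo := fun d hd => hbij.mapsTo hd
      mapsTo_inv := fun e he => hbij.surjOn.mapsTo_invFunOn he
      left_inv := hinv
      right_inv := fun e he => hbij.surjOn.rightInvOn_invFunOn he
      iso := hiso
      peak := fun d hd hP => (hPp.subset (Set.mem_image_of_mem T ⟨hP, hd⟩)).1
      peak_inv := fun e he hP => by
        obtain ⟨d, ⟨hdP, hd⟩, rfl⟩ := hPp.superset ⟨hP, he⟩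
        rwa [hinv d hd] }
  exact ⟨h.exists_homeomorph hk hX hY, fun _ hY2 _ _ h₁ h₂ y =>
    homeomorph_unique hk hY2 h₁ h₂ y⟩

end BanachStone
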